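/- Let φ(x) = e^{−x²/2}/√(2π) denote the standard normal density and Φ(x) = ∫_{−∞}^{x} φ(u) du the standard normal cumulative distribution function. Then the function x ↦ x·(1 − Φ(x))/φ(x) is strictly increasing on ℝ. -/

import Mathlib

/-- The standard normal density `φ(x) = e^{-x²/2}/√(2π)`. -/
noncomputable def stdphi (x : ℝ) : ℝ := Real.exp (-x ^ 2 / 2) / Real.sqrt (2 * Real.pi)

/-- The standard normal cumulative distribution function `Φ(x) = ∫_{-∞}^x φ`. -/
noncomputable def stdPhi (x : ℝ) : ℝ := ∫ u in Set.Iic x, stdphi u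

lemma stdphi_eq : stdphi = ProbabilityTheory.gaussianPDFReal 0 1 := by
  funext x
  simp [stdphi, ProbabilityTheory.gaussianPDFReal, div_eq_inv_mul, mul_comm]

lemma stdphi_int : MeasureTheory.Integrable stdphi := by
  rw [stdphi_eq]; exact ProbabilityTheory.integrable_gaussianPDFReal 0 1

lemma stdphi_total : ∫ x, stdphi x = 1 := by
  rw [stdphi_eq]; exact ProbabilityTheory.integral_gaussianPDFReal_eq_one 0 one_ne_zero

lemma stdphi_pos (x : ℝ) : 0 < stdphi x := by unfold stdphi; positivity

lemma stdphi_le (x : ℝ) : stdphi x ≤ 1 := by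
  unfold stdphi
  have h1 : Real.exp (-x ^ 2 / 2) ≤ 1 := Real.exp_le_one_iff.2 (by nlinarith [sq_nonneg x])
  have h2 : 1 ≤ Real.sqrt (2 * Real.pi) := by
    rw [Real.one_le_sqrt]; linarith [Real.pi_gt_three]
  rw [div_le_one (by linarith)]; linarith

lemma stdphi_deriv (x : ℝ) : HasDerivAt stdphi (-x * stdphi x) x := by
  have h : HasDerivAt (fun x : ℝ => -x ^ 2 / 2) (-x) x := by
    have := ((hasDerivAt_pow 2 x).neg).div_const 2
    refine HasDerivAt.congr_deriv this ?_
    simp; ring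
  have := h.exp.div_const (Real.sqrt (2 * Real.pi))
  refine HasDerivAt.congr_deriv this ?_
  unfold stdphi; ring

lemma stdphi_cont : Continuous stdphi :=
  continuous_iff_continuousAt.2 fun x => (stdphi_deriv x).continuousAt

lemma stdPhi_deriv (x : ℝ) : HasDerivAt stdPhi (stdphi x) x := by
  have h : stdPhi = fun y => stdPhi 0 + ∫ u in (0:ℝ)..y, stdphi u := by
    funext y
    rw [← intervalIntegral.integral_Iic_sub_Iic stdphi_int.integrableOn stdphi_int.integrableOn]
    simp [stdPhi]
  rw [h]
  exact (intervalIntegral.integral_hasDerivAt_right (stdphi_cont.intervalIntegrable _ _)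
    (stdphi_cont.stronglyMeasurableAtFilter _ _) stdphi_cont.continuousAt).const_add _

lemma stdPhi_tendsto : Filter.Tendsto stdPhi Filter.atTop (nhds 1) := by
  rw [← stdphi_total]
  exact (MeasureTheory.aecover_Iic Filter.tendsto_id).integral_tendsto_of_countably_generated
    stdphi_int

lemma gaux_deriv (x : ℝ) : HasDerivAt (fun x => 1 - stdPhi x - x * stdphi x / (1 + x ^ 2))
    (-(2 * stdphi x / (1 + x ^ 2) ^ 2)) x := by
  have hx : 1 + x ^ 2 ≠ 0 := by positivity
  have := ((stdPhi_deriv x).const_sub 1).sub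
    (((hasDerivAt_id x).mul (stdphi_deriv x)).div ((hasDerivAt_pow 2 x).const_add 1) hx)
  refine HasDerivAt.congr_deriv this ?_
  simp
  field_simp
  ring

lemma gaux_tendsto : Filter.Tendsto (fun x => 1 - stdPhi x - x * stdphi x / (1 + x ^ 2))
    Filter.atTop (nhds 0) := by
  have h : Filter.Tendsto (fun x => x * stdphi x / (1 + x ^ 2)) Filter.atTop (nhds 0) := by
    refine squeeze_zero' ?_ ?_ tendsto_inv_atTop_zero
    · filter_upwards [Filter.eventually_gt_atTop 0] with x hx
      have := stdphi_pos x
      positivity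
    · filter_upwards [Filter.eventually_gt_atTop 0] with x hx
      rw [inv_eq_one_div, div_le_div_iff₀ (by positivity) hx]
      nlinarith [mul_le_mul_of_nonneg_left (stdphi_le x) (sq_nonneg x)]
  simpa using (stdPhi_tendsto.const_sub 1).sub h

lemma gaux_pos (x : ℝ) : 0 < 1 - stdPhi x - x * stdphi x / (1 + x ^ 2) := by
  have hanti : StrictAnti (fun x => 1 - stdPhi x - x * stdphi x / (1 + x ^ 2)) := by
    apply strictAnti_of_deriv_neg
    intro y
    rw [(gaux_deriv y).deriv]
    have := stdphi_pos y
    have : 0 < 2 * stdphi y / (1 + y ^ 2) ^ 2 := by positivity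
    linarith
  have h1 := hanti.antitone.le_of_tendsto gaux_tendsto (x + 1)
  have h2 := hanti (lt_add_one x)
  exact lt_of_le_of_lt h1 h2

/-- **Strictly increasing curvature of normal-distribution demand.**
The function `x ↦ x·(1 - Φ(x))/φ(x)` is strictly increasing on `ℝ`. -/
theorem stmt15 : StrictMono (fun x => x * (1 - stdPhi x) / stdphi x) := by
  apply strictMono_of_deriv_pos
  intro x
  have hp := stdphi_pos x
  have hd := ((hasDerivAt_id x).mul ((stdPhi_deriv x).const_sub 1)).div (stdphi_deriv x) hp.ne'
  have hd' : HasDerivAt (fun x => x * (1 - stdPhi x) / stdphi x)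
      ((1 + x ^ 2) * (1 - stdPhi x - x * stdphi x / (1 + x ^ 2)) / stdphi x) x := by
    have hx : 1 + x ^ 2 ≠ 0 := by positivity
    refine HasDerivAt.congr_deriv hd ?_
    simp
    field_simp
    ring
  rw [hd'.deriv]
  have := gaux_pos x
  positivity
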